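/- Let A and B be nonzero integers with A² + 4B > 0 such that the Lucas sequence of the first kind u corresponding to (A,B) is non-degenerate. Assume that (A,B) is not one of (1,1), (-1,1), (1,2), (-1,2), that (A,B) is not of the form (2,B) with B ≥ 1, and not of the form (1,B) or (-1,B) with B ≥ 3. Then there is no triple (k,l,m) of nonnegative integers with u_k < u_l < u_m and u_k + u_m = 2·u_l. -/

import Mathlib

/-- Lucas sequence of the first kind for parameters `A`, `B`:
`u 0 = 0`, `u 1 = 1`, `u (n+2) = A * u (n+1) + B * u n`. -/
def lucasU (A B : ℤ) : ℕ → ℤ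
  | 0 => 0
  | 1 => 1
  | n + 2 => A * lucasU A B (n + 1) + B * lucasU A B n

theorem lucasU_add_two (A B : ℤ) (n : ℕ) :
    lucasU A B (n + 2) = A * lucasU A B (n + 1) + B * lucasU A B n := rfl

theorem lucasU_neg (A B : ℤ) (n : ℕ) :
    lucasU (-A) B n = (-1) ^ (n + 1) * lucasU A B n := by
  induction n using Nat.twoStepInduction with
  | zero => simp [lucasU]
  | one => simp [lucasU]
  | more n ih₁ ih₂ =>
    rw [lucasU_add_two, lucasU_add_two, ih₁, ih₂]
    ring

theorem lucasU_nonneg_and_ratio_lt {a B : ℤ} (ha : 3 ≤ a) (hB : B < 0) (hD : 0 < a ^ 2 + 4 * B)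
    (n : ℕ) :
    0 ≤ lucasU a B n ∧ (a + 1) * lucasU a B n < 2 * lucasU a B (n + 1) := by
  induction n with
  | zero => simp [lucasU]
  | succ n ih =>
    obtain ⟨h₀, h₁⟩ := ih
    have hpos : 0 < lucasU a B (n + 1) := by nlinarith
    refine ⟨hpos.le, ?_⟩
    rw [lucasU_add_two]
    have hstep : 0 < -B * (2 * lucasU a B (n + 1) - (a + 1) * lucasU a B n) :=
      mul_pos (by linarith) (by linarith)
    have hdisc : 0 ≤ (a ^ 2 + 4 * B - 1) * lucasU a B (n + 1) :=
      mul_nonneg (by linarith) hpos.le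
    refine lt_of_mul_lt_mul_left (a := a + 1) ?_ (by linarith)
    nlinarith

theorem lucasU_nonneg_of_pos {a B : ℤ} (ha : 0 ≤ a) (hB : 0 ≤ B) (n : ℕ) :
    0 ≤ lucasU a B n := by
  induction n using Nat.twoStepInduction with
  | zero => simp [lucasU]
  | one => simp [lucasU]
  | more n ih₁ ih₂ =>
    rw [lucasU_add_two]
    positivity

theorem lucasU_nonneg {a B : ℤ} (ha : 3 ≤ a) (hD : 0 < a ^ 2 + 4 * B) (n : ℕ) :
    0 ≤ lucasU a B n := by
  rcases le_or_gt 0 B with hB | hB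
  · exact lucasU_nonneg_of_pos (by linarith) hB n
  · exact (lucasU_nonneg_and_ratio_lt ha hB hD n).1

theorem two_mul_lucasU_lt {a B : ℤ} (ha : 3 ≤ a) (hD : 0 < a ^ 2 + 4 * B) (n : ℕ) :
    2 * lucasU a B n < lucasU a B (n + 1) := by
  rcases le_or_gt 0 B with hB | hB
  · have hnonneg := lucasU_nonneg_of_pos (a := a) (by linarith) hB
    induction n with
    | zero => simp [lucasU]
    | succ n ih =>
      rw [lucasU_add_two]
      have := hnonneg n
      nlinarith [mul_nonneg hB this]
  · obtain ⟨h₀, h₁⟩ := lucasU_nonneg_and_ratio_lt ha hB hD n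
    nlinarith

/-- A sequence of nonnegative integers at least doubling at each step has no three-term arithmetic
progressions once its signs alternate, provided it more than quadruples every two steps. -/
theorem no_alternating_arith_prog {v : ℕ → ℤ} (h₀ : ∀ n, 0 ≤ v n) (hv : StrictMono v)
    (h₂ : ∀ n, 2 * v n ≤ v (n + 1)) (h₄ : ∀ n, 4 * v n < v (n + 2)) {k l m : ℕ}
    (hkm : k ≠ m) (hkl : k ≠ l) (hlm : l ≠ m) :
    (-1) ^ (k + 1) * v k + (-1) ^ (m + 1) * v m ≠ 2 * ((-1) ^ (l + 1) * v l) := by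
  wlog hlt : k < m generalizing k m
  · rw [add_comm]
    exact this hkm.symm hlm.symm hkl.symm (by omega)
  intro h
  have hk := neg_one_pow_eq_or ℤ (k + 1)
  have hm := neg_one_pow_eq_or ℤ (m + 1)
  have hl := neg_one_pow_eq_or ℤ (l + 1)
  have hk₀ := h₀ k
  have hl₀ := h₀ l
  have hvkm := hv hlt
  rcases lt_or_gt_of_ne hlm with hlm | hlm
  · rcases Nat.lt_or_ge (l + 1) m with hl₁ | hl₁
    · obtain ⟨p, rfl⟩ : ∃ p, m = p + 2 := ⟨m - 2, by omega⟩
      have hlp : v l ≤ v p := hv.monotone (by omega)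
      have hkp : v k ≤ v (p + 1) := hv.monotone (by omega)
      have := h₂ p
      have := h₂ (p + 1)
      have := h₄ p
      rcases hk with hk | hk <;> rcases hm with hm | hm <;> rcases hl with hl | hl <;>
        rw [hk, hm, hl] at h <;> linarith
    · obtain rfl : m = l + 1 := by omega
      have hvkl := hv (show k < l by omega)
      rw [pow_succ _ (l + 1)] at h
      rcases hk with hk | hk <;> rcases hl with hl | hl <;>
        rw [hk, hl] at h <;> linarith
  · have hvml := hv hlm
    rcases hk with hk | hk <;> rcases hm with hm | hm <;> rcases hl with hl | hl <;>
      rw [hk, hm, hl] at h <;> linarith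

theorem no_arith_prog_of_two_mul_lt {v : ℕ → ℤ} (h₀ : ∀ n, 0 ≤ v n)
    (h₂ : ∀ n, 2 * v n < v (n + 1)) {k l m : ℕ} (hlm : v l < v m) :
    v k + v m ≠ 2 * v l := by
  have hv : StrictMono v := strictMono_nat_of_lt_succ fun n => by linarith [h₀ n, h₂ n]
  have := hv.monotone (Nat.succ_le_of_lt (hv.lt_iff_lt.1 hlm))
  have := h₂ l
  have := h₀ k
  simp only [Nat.succ_eq_add_one] at *
  linarith

theorem strictMono_lucasU_two {B : ℤ} (hB : 0 < B) : StrictMono (lucasU 2 B) := by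
  have h₀ := lucasU_nonneg_of_pos (a := 2) (by norm_num) hB.le
  refine strictMono_nat_of_lt_succ fun n => ?_
  induction n with
  | zero => simp [lucasU]
  | succ n ih =>
    rw [lucasU_add_two]
    nlinarith [h₀ n, mul_nonneg hB.le (h₀ n)]

theorem two_mul_lucasU_two_le {B : ℤ} (hB : 0 < B) (n : ℕ) :
    2 * lucasU 2 B n ≤ lucasU 2 B (n + 1) := by
  cases n with
  | zero => simp [lucasU]
  | succ n =>
    rw [lucasU_add_two]
    linarith [mul_nonneg hB.le (lucasU_nonneg_of_pos (a := 2) (by norm_num) hB.le n)]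

theorem four_mul_lucasU_two_lt {B : ℤ} (hB : 0 < B) (n : ℕ) :
    4 * lucasU 2 B n < lucasU 2 B (n + 2) := by
  rcases n.eq_zero_or_pos with rfl | hn
  · simp [lucasU]
  · have hpos := strictMono_lucasU_two hB hn
    rw [lucasU_add_two]
    have := two_mul_lucasU_two_le hB n
    have := mul_pos hB (show 0 < lucasU 2 B n from hpos)
    linarith

theorem stmt_4 (A B : ℤ) (hA : A ≠ 0) (hB : B ≠ 0) (hdom : A ^ 2 + 4 * B > 0)
    (hnd : ∀ α β : ℂ, α + β = (A : ℂ) → α * β = -(B : ℂ) →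
      ∀ n : ℕ, 0 < n → (α / β) ^ n ≠ 1)
    (h1 : (A, B) ≠ (1, 1)) (h2 : (A, B) ≠ (-1, 1)) (h3 : (A, B) ≠ (1, 2))
    (h4 : (A, B) ≠ (-1, 2))
    (h5 : ¬ (A = 2 ∧ B ≥ 1)) (h6 : ¬ (A = 1 ∧ B ≥ 3)) (h7 : ¬ (A = -1 ∧ B ≥ 3)) :
    ¬ ∃ k l m : ℕ, lucasU A B k < lucasU A B l ∧ lucasU A B l < lucasU A B m ∧
      lucasU A B k + lucasU A B m = 2 * lucasU A B l := by
  rintro ⟨k, l, m, hkl, hlm, h⟩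
  have hne : ∀ {i j : ℕ}, lucasU A B i < lucasU A B j → i ≠ j := by
    rintro i j hij rfl
    exact hij.false
  have hcases : 3 ≤ A ∨ 3 ≤ -A ∨ (A = -2 ∧ 0 < B) := by
    by_contra! hcon
    obtain ⟨hA₁, hA₂, hA₃⟩ := hcon
    have : -2 ≤ A := by omega
    have : A ≤ 2 := by omega
    interval_cases A <;> simp at * <;> omega
  rcases hcases with hA₃ | hA₃ | ⟨rfl, hB₀⟩
  · exact no_arith_prog_of_two_mul_lt (lucasU_nonneg hA₃ hdom) (two_mul_lucasU_lt hA₃ hdom) hlm h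
  · have hD : 0 < (-A) ^ 2 + 4 * B := by rwa [neg_sq]
    have h₀ := lucasU_nonneg hA₃ hD
    have h₂ := two_mul_lucasU_lt hA₃ hD
    have hsign := lucasU_neg (-A) B
    rw [neg_neg] at hsign
    have hkm := hne (hkl.trans hlm)
    have hkl' := hne hkl
    have hlm' := hne hlm
    rw [hsign, hsign, hsign] at h
    exact no_alternating_arith_prog h₀
      (strictMono_nat_of_lt_succ fun n => by linarith [h₀ n, h₂ n]) (fun n => (h₂ n).le)
      (fun n => by linarith [h₂ n, h₂ (n + 1)]) hkm hkl' hlm' h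
  · have hkm := hne (hkl.trans hlm)
    have hkl' := hne hkl
    have hlm' := hne hlm
    rw [lucasU_neg, lucasU_neg, lucasU_neg] at h
    exact no_alternating_arith_prog (lucasU_nonneg_of_pos (by norm_num) hB₀.le)
      (strictMono_lucasU_two hB₀) (two_mul_lucasU_two_le hB₀) (four_mul_lucasU_two_lt hB₀)
      hkm hkl' hlm' h
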